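/- arXiv:1602.00591 — 3 statements merged into one kernel-verified Lean document; each statement's English description precedes it below -/
import Mathlib

section
/- Let (x_i[n])_{i=1}^I, n ≥ 0, be the sequences generated by the inexact NEXT algorithm under Assumptions A, F, B, with step sizes α[n] ∈ (0, 1], Σ_n α[n] = ∞, Σ_n α[n]² < ∞, and error sequences (ε_i[n])_n nonnegative, uniformly bounded, with Σ_n α[n] ε_i[n] < ∞ for every i, and let x̄[n] := (1/I) Σ_{i=1}^I x_i[n]. Then for every i = 1,…,I: (i) lim_{n→∞} ‖x_i[n] − x̄[n]‖ = 0; (ii) Σ_{n=1}^∞ α[n] ‖x_i[n] − x̄[n]‖ < ∞; and (iii) Σ_{n=1}^∞ ‖x_i[n] − x̄[n]‖² < ∞. -/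
open Filter
open scoped InnerProductSpace

/-- A nonnegative sequence contracting over a fixed window up to a summable perturbation is
summable. -/
theorem summable_of_window_contraction {p q : ℕ → ℝ} {T : ℕ} {ρ : ℝ} (hρ : ρ < 1)
    (hp : ∀ n, 0 ≤ p n) (hq0 : ∀ n, 0 ≤ q n) (hq : Summable q)
    (h : ∀ n, p (n + T) ≤ ρ * p n + q n) : Summable p := by
  refine summable_of_sum_range_le (c := (∑ n ∈ Finset.range T, p n + ∑' n, q n) / (1 - ρ)) hp ?_
  intro N
  rw [le_div_iff₀ (by linarith)]
  have h1 : ∑ n ∈ Finset.range N, p n ≤ ∑ n ∈ Finset.range (T + N), p n :=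
    Finset.sum_le_sum_of_subset_of_nonneg (by simp) fun i _ _ => hp i
  rw [Finset.sum_range_add] at h1
  have h2 : ∑ n ∈ Finset.range N, p (T + n) ≤
      ρ * ∑ n ∈ Finset.range N, p n + ∑ n ∈ Finset.range N, q n := by
    rw [Finset.mul_sum, ← Finset.sum_add_distrib]
    exact Finset.sum_le_sum fun n _ => by simpa [add_comm] using h n
  have h3 := hq.sum_le_tsum (Finset.range N) fun i _ => hq0 i
  linarith

/-- Square-summability of a sequence contracting over a fixed window up to a square-summable
perturbation. -/
theorem summable_sq_of_window_contraction {a u : ℕ → ℝ} {T : ℕ} {ρ : ℝ} (hρ0 : 0 ≤ ρ)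
    (hρ : ρ < 1) (ha : ∀ n, 0 ≤ a n) (hu : Summable fun n => u n ^ 2)
    (h : ∀ n, a (n + T) ≤ ρ * a n + ∑ k ∈ Finset.range T, u (n + k)) :
    Summable fun n => a n ^ 2 := by
  have hq : Summable fun n => (1 - ρ)⁻¹ * (T * ∑ k ∈ Finset.range T, u (n + k) ^ 2) :=
    ((summable_sum fun k _ => (summable_nat_add_iff k).2 hu).mul_left _).mul_left _
  have hpos : 0 < 1 - ρ := by linarith
  refine summable_of_window_contraction (T := T) hρ (fun n => sq_nonneg _) (fun n => ?_) hq
    fun n => ?_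
  · have := Finset.sum_nonneg fun k (_ : k ∈ Finset.range T) => sq_nonneg (u (n + k))
    positivity
  · have hcs : (∑ k ∈ Finset.range T, u (n + k)) ^ 2 ≤ T * ∑ k ∈ Finset.range T, u (n + k) ^ 2 := by
      simpa using sq_sum_le_card_mul_sum_sq (s := Finset.range T) (f := fun k => u (n + k))
    set b := ∑ k ∈ Finset.range T, u (n + k)
    have h1 : a (n + T) ^ 2 ≤ (ρ * a n + b) ^ 2 := pow_le_pow_left₀ (ha _) (h n) 2
    have h2 : (ρ * a n + b) ^ 2 ≤ ρ * a n ^ 2 + (1 - ρ)⁻¹ * b ^ 2 := by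
      have h3 : ρ * a n ^ 2 + (1 - ρ)⁻¹ * b ^ 2 - (ρ * a n + b) ^ 2 =
          ρ * (1 - ρ)⁻¹ * ((1 - ρ) * a n - b) ^ 2 := by
        field_simp
        ring
      have : 0 ≤ ρ * (1 - ρ)⁻¹ * ((1 - ρ) * a n - b) ^ 2 := by positivity
      linarith
    have h4 : (1 - ρ)⁻¹ * b ^ 2 ≤ (1 - ρ)⁻¹ * (T * ∑ k ∈ Finset.range T, u (n + k) ^ 2) := by
      gcongr
    linarith

/-- Boundedness of a sequence contracting over a fixed window up to a bounded perturbation. -/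
theorem exists_le_of_window_contraction {a : ℕ → ℝ} {T : ℕ} {ρ M : ℝ} (hT : 0 < T)
    (hρ0 : 0 ≤ ρ) (hρ : ρ < 1) (h : ∀ n, a (n + T) ≤ ρ * a n + M) :
    ∃ C, ∀ n, a n ≤ C := by
  obtain ⟨A, hA⟩ := ((Finset.range T).image a).bddAbove
  have hpos : 0 < 1 - ρ := by linarith
  refine ⟨max A (M / (1 - ρ)), fun n => ?_⟩
  induction n using Nat.strong_induction_on with
  | _ n ih =>
    rcases lt_or_ge n T with hn | hn
    · exact (hA (by simpa using ⟨n, hn, rfl⟩)).trans (le_max_left _ _)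
    · obtain ⟨k, rfl⟩ := Nat.exists_eq_add_of_le' hn
      have h1 := mul_le_mul_of_nonneg_left (ih k (by omega)) hρ0
      have h2 := (div_le_iff₀ hpos).1 (le_max_right A (M / (1 - ρ)))
      linarith [h k]

/-- A convex function on a finite-dimensional Euclidean space has a subgradient at every point. -/
theorem ConvexOn.exists_subgradient {E : Type*} [NormedAddCommGroup E] [InnerProductSpace ℝ E]
    [FiniteDimensional ℝ E] {G : E → ℝ} (hG : ConvexOn ℝ Set.univ G) (x : E) :
    ∃ g : E, ∀ y, G x + ⟪g, y - x⟫_ℝ ≤ G y := by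
  have hcont : Continuous G := continuousOn_univ.1 (hG.continuousOn isOpen_univ)
  have hconv : Convex ℝ {p : E × ℝ | G p.1 < p.2} := by
    simpa using hG.convex_strict_epigraph
  have hopen : IsOpen {p : E × ℝ | G p.1 < p.2} :=
    isOpen_lt (hcont.comp continuous_fst) continuous_snd
  obtain ⟨φ, hφ⟩ := geometric_hahn_banach_open_point (x := (x, G x)) hconv hopen (by simp)
  have hsplit : ∀ y t, φ (y, t) = φ (y, 0) + t * φ (0, 1) := fun y t => by
    rw [← smul_eq_mul, ← map_smul, ← map_add]
    simp
  have hneg : φ (0, 1) < 0 := by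
    have := hφ (x, G x + 1) (by simp)
    rw [hsplit x (G x + 1), hsplit x (G x)] at this
    linarith
  refine ⟨(InnerProductSpace.toDual ℝ E).symm
    ((-φ (0, 1))⁻¹ • φ.comp (ContinuousLinearMap.inl ℝ E ℝ)), fun y => ?_⟩
  have hle : φ (y, 0) + G y * φ (0, 1) ≤ φ (x, 0) + G x * φ (0, 1) := by
    refine le_of_forall_pos_lt_add fun δ hδ => ?_
    have := hφ (y, G y + δ / (-φ (0, 1))) (by simpa using div_pos hδ (neg_pos.2 hneg))
    rw [hsplit y, hsplit x (G x)] at this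
    have h1 : δ / (-φ (0, 1)) * φ (0, 1) = -δ := by
      rw [div_neg, neg_mul, div_mul_cancel₀ _ hneg.ne]
    linarith
  have hsub : φ (y - x, 0) = φ (y, 0) - φ (x, 0) := by
    rw [← map_sub]
    simp
  rw [InnerProductSpace.toDual_symm_apply]
  simp only [smul_apply, ContinuousLinearMap.comp_apply,
    ContinuousLinearMap.inl_apply, smul_eq_mul, hsub]
  rw [inv_mul_eq_div, ← le_sub_iff_add_le', div_le_iff₀ (neg_pos.2 hneg)]
  linarith

/-- First-order lower bound for a strongly convex function. -/
theorem StrongConvexOn.add_inner_add_sq_le {E : Type*} [NormedAddCommGroup E]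
    [InnerProductSpace ℝ E] [CompleteSpace E] {s : Set E} {c : ℝ} {f : E → ℝ} {g x u : E}
    (hf : StrongConvexOn s c f) (hg : HasGradientAt f g x) (hx : x ∈ s) (hu : u ∈ s) :
    f x + ⟪g, u - x⟫_ℝ + c / 2 * ‖u - x‖ ^ 2 ≤ f u := by
  have hslope := (hg.hasFDerivAt.hasLineDerivAt (u - x)).tendsto_slope_zero_right
  rw [InnerProductSpace.toDual_apply_apply] at hslope
  have hright : Tendsto (fun t : ℝ => f u - f x - (1 - t) * (c / 2 * ‖u - x‖ ^ 2))
      (nhdsWithin 0 (Set.Ioi 0)) (nhds (f u - f x - (1 - 0) * (c / 2 * ‖u - x‖ ^ 2))) :=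
    (Continuous.tendsto (by fun_prop) 0).mono_left nhdsWithin_le_nhds
  have hle := le_of_tendsto_of_tendsto hslope hright (by
    filter_upwards [Ioo_mem_nhdsGT (zero_lt_one' ℝ)] with t ht
    have h := hf.2 hu hx ht.1.le (sub_nonneg.2 ht.2.le) (by ring)
    have hpt : t • u + (1 - t) • x = x + t • (u - x) := by module
    rw [hpt] at h
    simp only [smul_eq_mul] at h ⊢
    rw [inv_mul_eq_div, div_le_iff₀ ht.1]
    linarith)
  linarith

theorem norm_sum_smul_le_of_nonneg {ι E : Type*} [Fintype ι]
    [NormedAddCommGroup E] [NormedSpace ℝ E] {w : ι → ℝ} (hw : ∀ j, 0 ≤ w j) (z : ι → E) :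
    ‖∑ j, w j • z j‖ ≤ (∑ j, w j) * ‖z‖ := by
  rw [Finset.sum_mul]
  refine norm_sum_le_of_le _ fun j _ => ?_
  rw [norm_smul, Real.norm_of_nonneg (hw j)]
  exact mul_le_mul_of_nonneg_left (norm_le_pi_norm z j) (hw j)

/-- Product of the mixing matrices `W (s + t - 1) * ⋯ * W s`, entrywise. -/
def transition {ι : Type*} [Fintype ι] [DecidableEq ι] (W : ℕ → ι → ι → ℝ) (s : ℕ) :
    ℕ → ι → ι → ℝ
  | 0, i, j => if i = j then 1 else 0
  | t + 1, i, j => ∑ k, W (s + t) i k * transition W s t k j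

section Mixing

variable {ι : Type*} [Fintype ι] [DecidableEq ι] {W : ℕ → ι → ι → ℝ} {θ : ℝ} {B : ℕ}

theorem transition_nonneg (hW : ∀ n i j, 0 ≤ W n i j) (s t : ℕ) (i j : ι) :
    0 ≤ transition W s t i j := by
  induction t generalizing i with
  | zero => simp only [transition]; split_ifs <;> norm_num
  | succ t ih => exact Finset.sum_nonneg fun k _ => mul_nonneg (hW _ _ _) (ih k)

theorem sum_transition (hrow : ∀ n i, ∑ j, W n i j = 1) (s t : ℕ) (i : ι) :
    ∑ j, transition W s t i j = 1 := by
  induction t generalizing i with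
  | zero => simp [transition]
  | succ t ih =>
    simp only [transition]
    rw [Finset.sum_comm]
    simp_rw [← Finset.mul_sum, ih, mul_one, hrow]

theorem pow_le_transition_succ (hθ : 0 ≤ θ) (hW : ∀ n i j, 0 ≤ W n i j) {s t : ℕ} {i j k : ι}
    (hik : θ ≤ W (s + t) i k) (hkj : θ ^ t ≤ transition W s t k j) :
    θ ^ (t + 1) ≤ transition W s (t + 1) i j := by
  calc θ ^ (t + 1) = θ * θ ^ t := pow_succ' θ t
    _ ≤ W (s + t) i k * transition W s t k j :=
      mul_le_mul hik hkj (pow_nonneg hθ t) (hW _ _ _)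
    _ ≤ _ := Finset.single_le_sum (f := fun k => W (s + t) i k * transition W s t k j)
      (fun l _ => mul_nonneg (hW _ _ _) (transition_nonneg hW s t l j)) (Finset.mem_univ k)

theorem pow_le_transition_mono (hθ : 0 ≤ θ) (hW : ∀ n i j, 0 ≤ W n i j)
    (hdiag : ∀ n i, θ ≤ W n i i) {s t t' : ℕ} {i j : ι} (htt' : t ≤ t')
    (h : θ ^ t ≤ transition W s t i j) : θ ^ t' ≤ transition W s t' i j :=
  Nat.le_induction h (fun _ _ ih => pow_le_transition_succ hθ hW (hdiag _ _) ih) t' htt'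

/-- Under joint strong connectivity, the set of nodes reached from `j` grows in every window
until it contains all nodes. -/
theorem card_reached_lt (hθ : 0 ≤ θ) (hW : ∀ n i j, 0 ≤ W n i j)
    (hpos : ∀ n i j, 0 < W n i j → θ ≤ W n i j) (hdiag : ∀ n i, θ ≤ W n i i)
    (hconn : ∀ k : ℕ, ∀ a b : ι, Relation.ReflTransGen
      (fun u v : ι => ∃ n ∈ Finset.Ico (k * B) ((k + 1) * B), 0 < W n v u) a b)
    {s t₀ k₀ : ℕ} (hk₀ : k₀ * B = s + t₀) (j : ι) (l : ℕ) :
    (∀ i, θ ^ (t₀ + l * B) ≤ transition W s (t₀ + l * B) i j) ∨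
      l < (Finset.univ.filter
        fun i => θ ^ (t₀ + l * B) ≤ transition W s (t₀ + l * B) i j).card := by
  have hself : ∀ t, θ ^ t ≤ transition W s t j j := fun t =>
    pow_le_transition_mono hθ hW hdiag (Nat.zero_le t) (by simp [transition])
  induction l with
  | zero => exact Or.inr (Finset.card_pos.2 ⟨j, by simpa using hself _⟩)
  | succ l ih =>
    have hmono : ∀ i, θ ^ (t₀ + l * B) ≤ transition W s (t₀ + l * B) i j →
        θ ^ (t₀ + (l + 1) * B) ≤ transition W s (t₀ + (l + 1) * B) i j := fun i =>
      pow_le_transition_mono hθ hW hdiag (by rw [add_mul]; omega)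
    rcases ih with ih | ih
    · exact Or.inl fun i => hmono i (ih i)
    by_cases hall : ∀ i, θ ^ (t₀ + l * B) ≤ transition W s (t₀ + l * B) i j
    · exact Or.inl fun i => hmono i (hall i)
    right
    refine lt_of_le_of_lt (Nat.succ_le_of_lt ih) (Finset.card_lt_card ?_)
    rw [Finset.ssubset_iff_of_subset
      (Finset.monotone_filter_right _ fun i _ => hmono i)]
    by_contra! hnone
    simp only [Finset.mem_filter, Finset.mem_univ, true_and] at hnone
    refine hall fun b => ?_
    induction hconn (k₀ + l) j b with
    | refl => exact hself _
    | @tail u v _ huv ihu =>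
      obtain ⟨n, hn, hvu⟩ := huv
      rw [Finset.mem_Ico] at hn
      have h1 : (k₀ + l) * B = s + t₀ + l * B := by rw [add_mul, hk₀]
      have h2 : (k₀ + l + 1) * B = s + t₀ + (l + 1) * B := by rw [add_assoc, add_mul, hk₀]
      obtain ⟨t, rfl⟩ : ∃ t, n = s + t := ⟨n - s, by omega⟩
      exact hnone v (pow_le_transition_mono hθ hW hdiag (t := t + 1) (by omega)
        (pow_le_transition_succ hθ hW (hpos _ _ _ hvu)
          (pow_le_transition_mono hθ hW hdiag (by omega) ihu)))

theorem pow_le_transition (hB : 0 < B) (hθ : 0 ≤ θ) (hW : ∀ n i j, 0 ≤ W n i j)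
    (hpos : ∀ n i j, 0 < W n i j → θ ≤ W n i j) (hdiag : ∀ n i, θ ≤ W n i i)
    (hconn : ∀ k : ℕ, ∀ a b : ι, Relation.ReflTransGen
      (fun u v : ι => ∃ n ∈ Finset.Ico (k * B) ((k + 1) * B), 0 < W n v u) a b)
    (s : ℕ) (i j : ι) :
    θ ^ (B + Fintype.card ι * B) ≤ transition W s (B + Fintype.card ι * B) i j := by
  have hdm := Nat.div_add_mod' s B
  have hlt := Nat.mod_lt s hB
  have hk₀ : (s / B + 1) * B = s + (B - s % B) := by
    rw [add_mul, one_mul]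
    omega
  refine pow_le_transition_mono hθ hW hdiag (Nat.add_le_add_right (Nat.sub_le B (s % B)) _) ?_
  rcases card_reached_lt hθ hW hpos hdiag hconn hk₀ j (Fintype.card ι) with h | h
  · exact h i
  · exact absurd h (not_lt.2 (Finset.card_le_univ _))

variable {E : Type*} [NormedAddCommGroup E] [NormedSpace ℝ E]

theorem norm_sub_sum_transition_le (hW : ∀ n i j, 0 ≤ W n i j)
    (hrow : ∀ n i, ∑ j, W n i j = 1) {z : ℕ → ι → E} {u : ℕ → ℝ} (hu : ∀ n, 0 ≤ u n)
    (hz : ∀ n i, ‖z (n + 1) i - ∑ j, W n i j • z n j‖ ≤ u n) (s t : ℕ) (i : ι) :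
    ‖z (s + t) i - ∑ j, transition W s t i j • z s j‖ ≤ ∑ k ∈ Finset.range t, u (s + k) := by
  induction t generalizing i with
  | zero => simp [transition]
  | succ t ih =>
    have hexp : ∑ j, transition W s (t + 1) i j • z s j =
        ∑ k, W (s + t) i k • ∑ j, transition W s t k j • z s j := by
      simp only [transition, Finset.sum_smul, Finset.smul_sum, mul_smul]
      exact Finset.sum_comm
    have hdec : z (s + (t + 1)) i - ∑ j, transition W s (t + 1) i j • z s j =
        ∑ k, W (s + t) i k • (z (s + t) k - ∑ j, transition W s t k j • z s j) +
          (z (s + t + 1) i - ∑ k, W (s + t) i k • z (s + t) k) := by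
      simp only [hexp, smul_sub, Finset.sum_sub_distrib]
      rw [← add_assoc s t 1]
      abel
    rw [hdec, Finset.sum_range_succ]
    refine norm_add_le_of_le ?_ (hz _ _)
    refine (norm_sum_smul_le_of_nonneg (hW (s + t) i)
      fun k => z (s + t) k - ∑ j, transition W s t k j • z s j).trans ?_
    rw [hrow, one_mul]
    exact (pi_norm_le_iff_of_nonneg (Finset.sum_nonneg fun k _ => hu _)).2 ih

/-- Perturbed averaging over a jointly connected network contracts mean-zero states in the
supremum norm over windows of fixed length. -/
theorem exists_window_contraction [Nonempty ι] (hB : 0 < B) (hθ : 0 < θ)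
    (hW : ∀ n i j, 0 ≤ W n i j) (hpos : ∀ n i j, 0 < W n i j → θ ≤ W n i j)
    (hdiag : ∀ n i, θ ≤ W n i i) (hrow : ∀ n i, ∑ j, W n i j = 1)
    (hconn : ∀ k : ℕ, ∀ a b : ι, Relation.ReflTransGen
      (fun u v : ι => ∃ n ∈ Finset.Ico (k * B) ((k + 1) * B), 0 < W n v u) a b) :
    ∃ T : ℕ, 0 < T ∧ ∃ ρ : ℝ, 0 ≤ ρ ∧ ρ < 1 ∧ ∀ (z : ℕ → ι → E) (u : ℕ → ℝ),
      (∀ n, 0 ≤ u n) → (∀ n, ∑ i, z n i = 0) →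
      (∀ n i, ‖z (n + 1) i - ∑ j, W n i j • z n j‖ ≤ u n) →
      ∀ n, ‖z (n + T)‖ ≤ ρ * ‖z n‖ + ∑ k ∈ Finset.range T, u (n + k) := by
  set T := B + Fintype.card ι * B with hT
  have hlow : ∀ s i j, θ ^ T ≤ transition W s T i j :=
    pow_le_transition hB hθ.le hW hpos hdiag hconn
  have hsum : ∀ s i, ∑ j, (transition W s T i j - θ ^ T) = 1 - Fintype.card ι * θ ^ T :=
    fun s i => by simp [Finset.sum_sub_distrib, sum_transition hrow]
  have hρ0 : 0 ≤ 1 - Fintype.card ι * θ ^ T := by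
    rw [← hsum 0 (Classical.arbitrary ι)]
    exact Finset.sum_nonneg fun j _ => sub_nonneg.2 (hlow 0 _ j)
  have hcard : (0 : ℝ) < Fintype.card ι := by exact_mod_cast Fintype.card_pos
  refine ⟨T, by omega, 1 - Fintype.card ι * θ ^ T, hρ0, ?_, fun z u hu hz0 hz n => ?_⟩
  · have := mul_pos hcard (pow_pos hθ T)
    linarith
  · refine (pi_norm_le_iff_of_nonneg (add_nonneg (mul_nonneg hρ0 (norm_nonneg _))
      (Finset.sum_nonneg fun k _ => hu _))).2 fun i => ?_
    have hdec : z (n + T) i = ∑ j, (transition W n T i j - θ ^ T) • z n j +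
        (z (n + T) i - ∑ j, transition W n T i j • z n j) := by
      simp [sub_smul, Finset.sum_sub_distrib, ← Finset.smul_sum, hz0]
    rw [hdec]
    refine norm_add_le_of_le ?_ (norm_sub_sum_transition_le hW hrow hu hz n T i)
    rw [← hsum n i]
    exact norm_sum_smul_le_of_nonneg (fun j => sub_nonneg.2 (hlow n i j)) (z n)

end Mixing

theorem norm_average_le {ι E : Type*} [Fintype ι] [Nonempty ι] [NormedAddCommGroup E]
    [NormedSpace ℝ E] {v : ι → E} {c : ℝ} (hv : ∀ i, ‖v i‖ ≤ c) :
    ‖(Fintype.card ι : ℝ)⁻¹ • ∑ i, v i‖ ≤ c := by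
  have hcard : (0 : ℝ) < Fintype.card ι := by exact_mod_cast Fintype.card_pos
  rw [norm_smul, norm_inv, RCLike.norm_natCast, inv_mul_le_iff₀ hcard]
  simpa using norm_sum_le_of_le Finset.univ fun i _ => hv i

/-- Deviations from the average obey the averaging recursion up to twice the perturbation. -/
theorem norm_deviation_sub_le {ι E : Type*} [Fintype ι] [Nonempty ι] [NormedAddCommGroup E]
    [NormedSpace ℝ E] {w : ι → ι → ℝ} (hrow : ∀ i, ∑ j, w i j = 1) (hcol : ∀ j, ∑ i, w i j = 1)
    {x x' : ι → E} {c : ℝ} (h : ∀ i, ‖x' i - ∑ j, w i j • x j‖ ≤ c) (i : ι) :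
    ‖(x' i - (Fintype.card ι : ℝ)⁻¹ • ∑ k, x' k) -
      ∑ j, w i j • (x j - (Fintype.card ι : ℝ)⁻¹ • ∑ k, x k)‖ ≤ 2 * c := by
  have hmean : ∑ i, (x' i - ∑ j, w i j • x j) = ∑ k, x' k - ∑ k, x k := by
    rw [Finset.sum_sub_distrib, Finset.sum_comm]
    simp_rw [← Finset.sum_smul, hcol, one_smul]
  have hdec : (x' i - (Fintype.card ι : ℝ)⁻¹ • ∑ k, x' k) -
      ∑ j, w i j • (x j - (Fintype.card ι : ℝ)⁻¹ • ∑ k, x k) =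
      (x' i - ∑ j, w i j • x j) -
        (Fintype.card ι : ℝ)⁻¹ • ∑ i, (x' i - ∑ j, w i j • x j) := by
    rw [hmean]
    simp only [smul_sub, Finset.sum_sub_distrib, ← Finset.sum_smul, hrow, one_smul]
    abel
  rw [hdec, two_mul]
  exact norm_sub_le_of_le (h i) (norm_average_le h)

theorem sum_deviation_eq_zero {ι E : Type*} [Fintype ι] [Nonempty ι] [AddCommGroup E] [Module ℝ E]
    (x : ι → E) : ∑ i, (x i - (Fintype.card ι : ℝ)⁻¹ • ∑ k, x k) = 0 := by
  have hcard : (Fintype.card ι : ℝ) ≠ 0 := by exact_mod_cast Fintype.card_ne_zero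
  rw [Finset.sum_sub_distrib, Finset.sum_const, Finset.card_univ, ← Nat.cast_smul_eq_nsmul ℝ,
    smul_smul, mul_inv_cancel₀ hcard, one_smul, sub_self]

/-- A point whose strongly convex plus convex composite value does not exceed that at `x` lies
within a distance of `x` controlled by the norm of a subgradient at `x`. -/
theorem StrongConvexOn.norm_sub_le_of_composite_le {E : Type*} [NormedAddCommGroup E]
    [InnerProductSpace ℝ E] [CompleteSpace E] {s : Set E} {c : ℝ} {f G : E → ℝ} {g p ξ x u : E}
    (hc : 0 < c) (hf : StrongConvexOn s c f) (hg : HasGradientAt f g x) (hx : x ∈ s) (hu : u ∈ s)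
    (hξ : ∀ y, G x + ⟪ξ, y - x⟫_ℝ ≤ G y)
    (hle : f u + ⟪p, u - x⟫_ℝ + G u ≤ f x + ⟪p, x - x⟫_ℝ + G x) :
    ‖u - x‖ ≤ 2 * ‖g + p + ξ‖ / c := by
  have h1 := hf.add_inner_add_sq_le hg hx hu
  have h2 := hξ u
  have h3 := neg_le_of_abs_le (abs_real_inner_le_norm (g + p + ξ) (u - x))
  rw [inner_add_left, inner_add_left] at h3
  rw [sub_self, inner_zero_right] at hle
  rw [le_div_iff₀ hc]
  rcases (norm_nonneg (u - x)).eq_or_lt with h0 | h0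
  · rw [← h0]
    simp
  · refine le_of_mul_le_mul_right ?_ h0
    linarith

/-- Asymptotic agreement in the inexact NEXT algorithm: the consensus errors vanish, are summable against the step sizes, and square-summable. -/
theorem stmt_12 {m I : ℕ} (hI : 0 < I)
    (K : Set (EuclideanSpace ℝ (Fin m)))
    (hKne : K.Nonempty) (hKcl : IsClosed K) (hKcv : Convex ℝ K)
    (f : Fin I → EuclideanSpace ℝ (Fin m) → ℝ)
    (gf : Fin I → EuclideanSpace ℝ (Fin m) → EuclideanSpace ℝ (Fin m))
    (Uo : Set (EuclideanSpace ℝ (Fin m))) (hUo : IsOpen Uo) (hKUo : K ⊆ Uo)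
    (hdiff : ∀ i, ∀ x ∈ Uo, HasGradientAt (f i) (gf i x) x)
    (hgradcont : ∀ i, ContinuousOn (gf i) Uo)
    (L : Fin I → ℝ)
    (hLip : ∀ i, ∀ x ∈ K, ∀ y ∈ K, ‖gf i x - gf i y‖ ≤ L i * ‖x - y‖)
    (LF : ℝ) (hLF : 0 < LF)
    (hgb : ∀ i, ∀ x ∈ K, ‖gf i x‖ ≤ LF)
    (G : EuclideanSpace ℝ (Fin m) → ℝ) (hG : ConvexOn ℝ Set.univ G)
    (LG : ℝ)
    (hsub : ∀ x ∈ K, ∀ g, (∀ y, G x + ⟪g, y - x⟫_ℝ ≤ G y) → ‖g‖ ≤ LG)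
    (hcoer : ∀ c : ℝ, ∃ r : ℝ, ∀ x ∈ K, r ≤ ‖x‖ → c ≤ (∑ i, f i x) + G x)
    (ft : Fin I → EuclideanSpace ℝ (Fin m) → EuclideanSpace ℝ (Fin m) → ℝ)
    (gft : Fin I → EuclideanSpace ℝ (Fin m) → EuclideanSpace ℝ (Fin m) → EuclideanSpace ℝ (Fin m))
    (τ : Fin I → ℝ) (hτ : ∀ i, 0 < τ i)
    (hF1 : ∀ i, ∀ z ∈ K, StrongConvexOn K (τ i) (fun x => ft i x z))
    (hftgrad : ∀ i, ∀ z ∈ K, ∀ x ∈ K, HasGradientAt (fun u => ft i u z) (gft i x z) x)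
    (hF2 : ∀ i, ∀ x ∈ K, gft i x x = gf i x)
    (Lt : ℝ)
    (hF3 : ∀ i, ∀ x ∈ K, ∀ w ∈ K, ∀ z ∈ K, ‖gft i x w - gft i x z‖ ≤ Lt * ‖w - z‖)
    (θ : ℝ) (hθ : θ ∈ Set.Ioo (0 : ℝ) 1)
    (W : ℕ → Fin I → Fin I → ℝ)
    (hWentries : ∀ n i j, W n i j = 0 ∨ W n i j ∈ Set.Icc θ 1)
    (hWdiag : ∀ n i, θ ≤ W n i i)
    (hWrow : ∀ n i, ∑ j, W n i j = 1)
    (hWcol : ∀ n j, ∑ i, W n i j = 1)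
    (B : ℕ) (hB : 0 < B)
    (hconn : ∀ k : ℕ, ∀ a b : Fin I,
      Relation.ReflTransGen
        (fun u v : Fin I => ∃ n ∈ Finset.Ico (k * B) ((k + 1) * B), 0 < W n v u) a b)
    (α : ℕ → ℝ) (hα : ∀ n, α n ∈ Set.Ioc (0 : ℝ) 1)
    (hαdiv : ¬ Summable α)
    (hαsq : Summable (fun n => (α n) ^ 2))
    (x xt y πt : Fin I → ℕ → EuclideanSpace ℝ (Fin m))
    (hx0 : ∀ i, x i 0 ∈ K)
    (hy0 : ∀ i, y i 0 = gf i (x i 0))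
    (hπt : ∀ i n, πt i n = (I : ℝ) • y i n - gf i (x i n))
    (hxt : ∀ i n, xt i n ∈ K ∧ ∀ u ∈ K, u ≠ xt i n →
      ft i (xt i n) (x i n) + ⟪πt i n, xt i n - x i n⟫_ℝ + G (xt i n)
        < ft i u (x i n) + ⟪πt i n, u - x i n⟫_ℝ + G u)
    (hyrec : ∀ i n, y i (n + 1) = (∑ j, W n i j • y j n) + gf i (x i (n + 1)) - gf i (x i n))
    (ε : Fin I → ℕ → ℝ) (hεnn : ∀ i n, 0 ≤ ε i n)
    (hεbd : ∃ Cb : ℝ, ∀ i n, ε i n ≤ Cb)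
    (hεsum : ∀ i, Summable (fun n => α n * ε i n))
    (xinx : Fin I → ℕ → EuclideanSpace ℝ (Fin m))
    (hinx : ∀ i n, xinx i n ∈ K ∧ ‖xinx i n - xt i n‖ ≤ ε i n)
    (hxrec : ∀ i n, x i (n + 1) = ∑ j, W n i j • (x j n + α n • (xinx j n - x j n)))
    (xbar : ℕ → EuclideanSpace ℝ (Fin m)) (hxbar : ∀ n, xbar n = (I : ℝ)⁻¹ • ∑ j, x j n) :
    ∀ i,
      Filter.Tendsto (fun n => ‖x i n - xbar n‖) Filter.atTop (nhds 0) ∧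
      Summable (fun n => α n * ‖x i n - xbar n‖) ∧
      Summable (fun n => ‖x i n - xbar n‖ ^ 2) := by
  have : Nonempty (Fin I) := ⟨⟨0, hI⟩⟩
  have hW : ∀ n i j, 0 ≤ W n i j := fun n i j =>
    (hWentries n i j).elim (fun h => h.ge) fun h => hθ.1.le.trans h.1
  have hpos : ∀ n i j, 0 < W n i j → θ ≤ W n i j := fun n i j h =>
    (hWentries n i j).elim (fun h0 => absurd h0 h.ne') fun h => h.1
  obtain ⟨T, hT, ρ, hρ0, hρ1, hcontr⟩ :=
    exists_window_contraction (E := EuclideanSpace ℝ (Fin m)) hB hθ.1 hW hpos hWdiag hWrow hconn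
  have hdev : ∀ (v : Fin I → ℕ → EuclideanSpace ℝ (Fin m)) (u : ℕ → ℝ), (∀ n, 0 ≤ u n) →
      (∀ n i, ‖v i (n + 1) - ∑ j, W n i j • v j n‖ ≤ u n) →
      ∀ n, ‖fun i => v i (n + T) - (I : ℝ)⁻¹ • ∑ k, v k (n + T)‖ ≤
        ρ * ‖fun i => v i n - (I : ℝ)⁻¹ • ∑ k, v k n‖ +
          ∑ k ∈ Finset.range T, 2 * u (n + k) := fun v u hu hv =>
    hcontr (fun n i => v i n - (I : ℝ)⁻¹ • ∑ k, v k n) (fun n => 2 * u n)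
      (fun n => mul_nonneg zero_le_two (hu n))
      (fun n => by simpa using sum_deviation_eq_zero fun i => v i n)
      (fun n i => by
        simpa using norm_deviation_sub_le (hWrow n) (hWcol n) (x := fun j => v j n)
          (x' := fun j => v j (n + 1)) (hv n) i)
  have hxK : ∀ n i, x i n ∈ K := by
    intro n
    induction n with
    | zero => exact hx0
    | succ n ih =>
      intro i
      rw [hxrec]
      refine hKcv.sum_mem (fun j _ => hW n i j) (hWrow n i) fun j _ => ?_
      exact hKcv.add_smul_sub_mem (ih j) (hinx j n).1 ⟨(hα n).1.le, (hα n).2⟩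
  have hysum : ∀ n, ∑ i, y i n = ∑ i, gf i (x i n) := by
    intro n
    induction n with
    | zero => simp [hy0]
    | succ n ih =>
      simp_rw [hyrec]
      rw [Finset.sum_sub_distrib, Finset.sum_add_distrib, Finset.sum_comm]
      simp_rw [← Finset.sum_smul, hWcol, one_smul]
      rw [ih]
      abel
  obtain ⟨Cy, hCy⟩ : ∃ Cy, ∀ i n, ‖y i n‖ ≤ Cy := by
    obtain ⟨C, hC⟩ := exists_le_of_window_contraction hT hρ0 hρ1
      (a := fun n => ‖fun i => y i n - (I : ℝ)⁻¹ • ∑ k, y k n‖)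
      (M := ∑ k ∈ Finset.range T, 2 * (LF + LF))
      (hdev y (fun _ => LF + LF) (fun _ => by positivity) fun n i => by
        have hstep : y i (n + 1) - ∑ j, W n i j • y j n =
            gf i (x i (n + 1)) - gf i (x i n) := by
          rw [hyrec]
          abel
        rw [hstep]
        exact norm_sub_le_of_le (hgb i _ (hxK _ i)) (hgb i _ (hxK _ i)))
    refine ⟨C + LF, fun i n => ?_⟩
    have havg : ‖(I : ℝ)⁻¹ • ∑ k, y k n‖ ≤ LF := by
      rw [hysum]
      simpa using norm_average_le (v := fun k => gf k (x k n)) fun k => hgb k _ (hxK n k)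
    rw [← sub_add_cancel (y i n) ((I : ℝ)⁻¹ • ∑ k, y k n)]
    exact norm_add_le_of_le ((norm_le_pi_norm
      (fun i => y i n - (I : ℝ)⁻¹ • ∑ k, y k n) i).trans (hC n)) havg
  obtain ⟨Cε, hCε⟩ := hεbd
  obtain ⟨c, hc0, hc⟩ : ∃ c, 0 ≤ c ∧ ∀ i n, ‖xinx i n - x i n‖ ≤ c := by
    have hbound : ∀ i n, ‖xinx i n - x i n‖ ≤ Cε + 2 * (I * Cy + LG) / τ i := by
      intro i n
      obtain ⟨ξ, hξ⟩ := hG.exists_subgradient (x i n)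
      have hopt : ft i (xt i n) (x i n) + ⟪πt i n, xt i n - x i n⟫_ℝ + G (xt i n) ≤
          ft i (x i n) (x i n) + ⟪πt i n, x i n - x i n⟫_ℝ + G (x i n) := by
        rcases eq_or_ne (x i n) (xt i n) with h | h
        · rw [← h]
        · exact ((hxt i n).2 _ (hxK n i) h).le
      have hbest := (hF1 i _ (hxK n i)).norm_sub_le_of_composite_le (hτ i)
        (hftgrad i _ (hxK n i) _ (hxK n i)) (hxK n i) (hxt i n).1 hξ hopt
      have hgrad : gft i (x i n) (x i n) + πt i n + ξ = (I : ℝ) • y i n + ξ := by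
        rw [hF2 i _ (hxK n i), hπt]
        abel
      have hnorm : ‖(I : ℝ) • y i n + ξ‖ ≤ I * Cy + LG := by
        refine norm_add_le_of_le ?_ (hsub _ (hxK n i) ξ hξ)
        rw [norm_smul, RCLike.norm_natCast]
        exact mul_le_mul_of_nonneg_left (hCy i n) (Nat.cast_nonneg I)
      rw [hgrad] at hbest
      rw [← sub_add_sub_cancel _ (xt i n)]
      refine norm_add_le_of_le ((hinx i n).2.trans (hCε i n)) (hbest.trans ?_)
      have := hτ i
      gcongr
    obtain ⟨c, hc⟩ := (Set.finite_range fun i => Cε + 2 * (I * Cy + LG) / τ i).bddAbove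
    have hle : ∀ i n, ‖xinx i n - x i n‖ ≤ c := fun i n =>
      (hbound i n).trans (hc (Set.mem_range_self i))
    exact ⟨c, (norm_nonneg _).trans (hle ⟨0, hI⟩ 0), hle⟩
  have hsq : Summable fun n => ‖fun i => x i n - (I : ℝ)⁻¹ • ∑ k, x k n‖ ^ 2 := by
    refine summable_sq_of_window_contraction (u := fun n => 2 * (α n * c)) hρ0 hρ1
      (fun n => norm_nonneg _) ?_ (hdev x (fun n => α n * c)
        (fun n => mul_nonneg (hα n).1.le hc0) fun n i => ?_)
    · refine (hαsq.mul_left ((2 * c) ^ 2)).congr fun n => ?_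
      ring
    · have hstep : x i (n + 1) - ∑ j, W n i j • x j n =
          ∑ j, W n i j • α n • (xinx j n - x j n) := by
        rw [hxrec]
        simp only [smul_add, Finset.sum_add_distrib]
        abel
      rw [hstep]
      refine (norm_sum_smul_le_of_nonneg (hW n i) fun j => α n • (xinx j n - x j n)).trans ?_
      rw [hWrow, one_mul, pi_norm_le_iff_of_nonneg (mul_nonneg (hα n).1.le hc0)]
      intro j
      rw [norm_smul, Real.norm_of_nonneg (hα n).1.le]
      exact mul_le_mul_of_nonneg_left (hc j n) (hα n).1.le
  intro i
  have hsqi : Summable fun n => ‖x i n - xbar n‖ ^ 2 := by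
    refine hsq.of_nonneg_of_le (fun n => sq_nonneg _) fun n => ?_
    rw [hxbar]
    exact pow_le_pow_left₀ (norm_nonneg _)
      (norm_le_pi_norm (fun i => x i n - (I : ℝ)⁻¹ • ∑ k, x k n) i) 2
  refine ⟨?_, ?_, hsqi⟩
  · have := hsqi.tendsto_atTop_zero.sqrt
    simpa using this
  · refine (hαsq.add hsqi).of_nonneg_of_le
      (fun n => mul_nonneg (hα n).1.le (norm_nonneg _)) fun n => ?_
    have := two_mul_le_add_sq (α n) ‖x i n - xbar n‖
    have := mul_nonneg (hα n).1.le (norm_nonneg (x i n - xbar n))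
    linarith
end

section
/- Let K ⊆ ℝ^m be a nonempty closed convex set, let h : ℝ^m → ℝ be differentiable and strongly convex on K with constant τ > 0, and let G : ℝ^m → ℝ be convex. For a, b ∈ ℝ^m, let x_a be a minimizer over K of x ↦ h(x) + aᵀx + G(x), and let x_b be a minimizer over K of x ↦ h(x) + bᵀx + G(x). Then ‖x_a − x_b‖ ≤ ‖a − b‖ / τ. -/
open scoped InnerProductSpace

/-- First-order optimality condition for the sum of a differentiable and a convex function:
if `x` minimizes `f + G` over the convex set `K`, then
`0 ≤ ⟪∇f(x), y − x⟫ + G(y) − G(x)` for every `y ∈ K`. -/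
theorem IsMinOn.inner_gradient_add_convexOn_nonneg {E : Type*} [NormedAddCommGroup E]
    [InnerProductSpace ℝ E] [CompleteSpace E] {K : Set E} {f G : E → ℝ} {g x y : E}
    (hmin : IsMinOn (f + G) K x) (hf : HasGradientAt f g x) (hG : ConvexOn ℝ K G)
    (hx : x ∈ K) (hy : y ∈ K) :
    0 ≤ ⟪g, y - x⟫_ℝ + (G y - G x) := by
  have hline : HasDerivAt (fun t : ℝ ↦ x + t • (y - x)) (y - x) 0 := by
    simpa using ((hasDerivAt_id (0 : ℝ)).smul_const (y - x)).const_add x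
  have hf' : HasFDerivAt f (InnerProductSpace.toDual ℝ E g) (x + (0 : ℝ) • (y - x)) := by
    simpa using hf.hasFDerivAt
  have hφ : HasDerivAt (fun t : ℝ ↦ f (x + t • (y - x)) + t * (G y - G x))
      (⟪g, y - x⟫_ℝ + (G y - G x)) 0 := by
    have hsum := (hf'.comp_hasDerivAt (0 : ℝ) hline).add
      ((hasDerivAt_id (0 : ℝ)).mul_const (G y - G x))
    rw [InnerProductSpace.toDual_apply_apply, one_mul] at hsum
    exact hsum
  have hφmin : IsMinOn (fun t : ℝ ↦ f (x + t • (y - x)) + t * (G y - G x))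
      (Set.Icc 0 1) 0 := by
    rintro t ⟨ht0, ht1⟩
    have hcomb : x + t • (y - x) = (1 - t) • x + t • y := by module
    have hmem : x + t • (y - x) ∈ K := by
      rw [hcomb]
      exact hG.1 hx hy (by linarith) ht0 (by ring)
    have hGt : G (x + t • (y - x)) ≤ (1 - t) * G x + t * G y := by
      rw [hcomb]
      exact hG.2 hx hy (by linarith) ht0 (by ring)
    have hxt : f x + G x ≤ f (x + t • (y - x)) + G (x + t • (y - x)) := hmin hmem
    simp only [Set.mem_ofPred_eq, zero_smul, add_zero, zero_mul]
    linarith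
  have hcone : (1 : ℝ) ∈ posTangentConeAt (Set.Icc (0 : ℝ) 1) 0 :=
    mem_posTangentConeAt_of_segment_subset (by simp [segment_eq_Icc])
  simpa using hφmin.localize.hasFDerivWithinAt_nonneg hφ.hasFDerivAt.hasFDerivWithinAt hcone

/-- If `h` is differentiable and `τ`-strongly convex on the nonempty closed convex set `K`,
`G` is convex, and `x_a`, `x_b` minimize `x ↦ h(x) + aᵀx + G(x)` and `x ↦ h(x) + bᵀx + G(x)`
over `K` respectively, then `‖x_a − x_b‖ ≤ ‖a − b‖ / τ`. -/
theorem stmt_15 {m : ℕ}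
    (K : Set (EuclideanSpace ℝ (Fin m)))
    (hKne : K.Nonempty) (hKcl : IsClosed K) (hKcv : Convex ℝ K)
    (h : EuclideanSpace ℝ (Fin m) → ℝ)
    (gh : EuclideanSpace ℝ (Fin m) → EuclideanSpace ℝ (Fin m))
    (hdiff : ∀ x, HasGradientAt h (gh x) x)
    (τ : ℝ) (hτ : 0 < τ)
    (hsc : ∀ x ∈ K, ∀ y ∈ K, τ * ‖x - y‖ ^ 2 ≤ ⟪gh x - gh y, x - y⟫_ℝ)
    (G : EuclideanSpace ℝ (Fin m) → ℝ) (hG : ConvexOn ℝ Set.univ G)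
    (a b xa xb : EuclideanSpace ℝ (Fin m)) (hxa : xa ∈ K) (hxb : xb ∈ K)
    (hmina : ∀ x ∈ K, h xa + ⟪a, xa⟫_ℝ + G xa ≤ h x + ⟪a, x⟫_ℝ + G x)
    (hminb : ∀ x ∈ K, h xb + ⟪b, xb⟫_ℝ + G xb ≤ h x + ⟪b, x⟫_ℝ + G x) :
    ‖xa - xb‖ ≤ ‖a - b‖ / τ := by
  have hopt : ∀ c x y : EuclideanSpace ℝ (Fin m), x ∈ K → y ∈ K →
      (∀ z ∈ K, h x + ⟪c, x⟫_ℝ + G x ≤ h z + ⟪c, z⟫_ℝ + G z) →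
      0 ≤ ⟪gh x + c, y - x⟫_ℝ + (G y - G x) := by
    intro c x y hx hy hmin
    have hgrad : HasGradientAt (fun z ↦ h z + ⟪c, z⟫_ℝ) (gh x + c) x := by
      rw [hasGradientAt_iff_hasFDerivAt, map_add]
      exact (hdiff x).hasFDerivAt.add (InnerProductSpace.toDual ℝ _ c).hasFDerivAt
    have hmin' : IsMinOn ((fun z ↦ h z + ⟪c, z⟫_ℝ) + G) K x := hmin
    exact hmin'.inner_gradient_add_convexOn_nonneg hgrad
      (hG.subset (Set.subset_univ K) hKcv) hx hy
  have ha := hopt a xa xb hxa hxb hmina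
  have hb := hopt b xb xa hxb hxa hminb
  have hmono := hsc xa hxa xb hxb
  have hcs := real_inner_le_norm (b - a) (xa - xb)
  rw [norm_sub_rev b a] at hcs
  have hquad : τ * ‖xa - xb‖ ^ 2 ≤ ‖a - b‖ * ‖xa - xb‖ := by
    simp only [inner_sub_left, inner_sub_right, inner_add_left] at ha hb hmono hcs
    linarith
  rw [le_div_iff₀ hτ]
  rcases (norm_nonneg (xa - xb)).eq_or_lt with h0 | hpos
  · simp [← h0]
  · exact le_of_mul_le_mul_right (by linarith) hpos
end

section
/- For each n ≥ 0 and i = 1,…,I, let r_i[n] ∈ ℝ^m satisfy ‖r_i[n]‖ ≤ R for a finite constant R, and define the dynamic-consensus sequences y_i[0] := r_i[0] and y_i[n+1] := Σ_{j=1}^I w_{ij}[n] y_j[n] + r_i[n+1] − r_i[n], and the averages r̄[n] := (1/I) Σ_{i=1}^I r_i[n]. Then the tracking error is uniformly bounded: sup_{n ≥ 0} max_{1 ≤ i ≤ I} ‖y_i[n] − r̄[n]‖ < ∞. -/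
open Finset

/-- The product `W (s + t - 1) * ⋯ * W s` of `t` consecutive matrices. -/
def transitionMatrix {ι : Type*} [Fintype ι] [DecidableEq ι] (W : ℕ → Matrix ι ι ℝ) (s : ℕ) :
    ℕ → Matrix ι ι ℝ
  | 0 => 1
  | t + 1 => W (s + t) * transitionMatrix W s t

section TransitionMatrix

variable {ι : Type*} [Fintype ι] [DecidableEq ι] {W : ℕ → Matrix ι ι ℝ}

lemma transitionMatrix_nonneg (hW : ∀ n i j, 0 ≤ W n i j) (s t : ℕ) (i j : ι) :
    0 ≤ transitionMatrix W s t i j := by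
  induction t generalizing i with
  | zero =>
    simp only [transitionMatrix, Matrix.one_apply]
    split_ifs <;> norm_num
  | succ t ih =>
    simp only [transitionMatrix, Matrix.mul_apply]
    exact sum_nonneg fun k _ => mul_nonneg (hW _ _ _) (ih k)

lemma sum_transitionMatrix (hrow : ∀ n i, ∑ j, W n i j = 1) (s t : ℕ) (i : ι) :
    ∑ j, transitionMatrix W s t i j = 1 := by
  induction t generalizing i with
  | zero => simp [transitionMatrix, Matrix.one_apply]
  | succ t ih =>
    simp only [transitionMatrix, Matrix.mul_apply]
    rw [sum_comm]
    simp [← mul_sum, ih, hrow]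

lemma pow_succ_le_transitionMatrix {θ : ℝ} (hθ : 0 ≤ θ) (hW : ∀ n i j, 0 ≤ W n i j)
    {s t : ℕ} {i j k : ι} (hik : θ ≤ W (s + t) i k) (hkj : θ ^ t ≤ transitionMatrix W s t k j) :
    θ ^ (t + 1) ≤ transitionMatrix W s (t + 1) i j := by
  simp only [transitionMatrix, Matrix.mul_apply]
  calc θ ^ (t + 1) = θ * θ ^ t := pow_succ' θ t
    _ ≤ W (s + t) i k * transitionMatrix W s t k j :=
        mul_le_mul hik hkj (pow_nonneg hθ t) (hW _ _ _)
    _ ≤ _ := single_le_sum (f := fun k => W (s + t) i k * transitionMatrix W s t k j)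
        (fun l _ => mul_nonneg (hW _ _ _) (transitionMatrix_nonneg hW s t l j)) (mem_univ k)

lemma pow_le_transitionMatrix_mono {θ : ℝ} (hθ : 0 ≤ θ) (hW : ∀ n i j, 0 ≤ W n i j)
    (hdiag : ∀ n i, θ ≤ W n i i) {s t t' : ℕ} (htt' : t ≤ t') {i j : ι}
    (h : θ ^ t ≤ transitionMatrix W s t i j) : θ ^ t' ≤ transitionMatrix W s t' i j := by
  induction t', htt' using Nat.le_induction with
  | base => exact h
  | succ n _ ih => exact pow_succ_le_transitionMatrix hθ hW (hdiag _ _) ih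

/-- A relation whose reflexive transitive closure is total leaves every nonempty proper subset. -/
lemma exists_rel_mem_notMem_of_reflTransGen {α : Type*} {p : α → α → Prop} {S : Set α} {a b : α}
    (h : Relation.ReflTransGen p a b) (ha : a ∈ S) (hb : b ∉ S) :
    ∃ u v, p u v ∧ u ∈ S ∧ v ∉ S := by
  induction h with
  | refl => exact absurd ha hb
  | @tail c d _ hcd ih =>
    by_cases hc : c ∈ S
    · exact ⟨c, d, hcd, hc, hb⟩
    · exact ih hc

/-- Over `card ι` blocks of length `B`, every entry of the transition matrix becomes at least
`θ ^ (card ι * B)`. -/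
lemma pow_le_transitionMatrix {θ : ℝ} (hθ : 0 ≤ θ) (hW : ∀ n i j, 0 ≤ W n i j)
    (hpos : ∀ n i j, 0 < W n i j → θ ≤ W n i j) (hdiag : ∀ n i, θ ≤ W n i i) {B : ℕ}
    (hconn : ∀ k : ℕ, ∀ a b : ι, Relation.ReflTransGen
      (fun u v => ∃ n ∈ Ico (k * B) ((k + 1) * B), 0 < W n v u) a b)
    (k : ℕ) (i j : ι) :
    θ ^ (Fintype.card ι * B) ≤ transitionMatrix W (k * B) (Fintype.card ι * B) i j := by
  classical
  let S : ℕ → Finset ι := fun t => {i | θ ^ t ≤ transitionMatrix W (k * B) t i j}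
  have mem_S : ∀ t i, i ∈ S t ↔ θ ^ t ≤ transitionMatrix W (k * B) t i j := by simp [S]
  have mono : ∀ {t t'}, t ≤ t' → S t ⊆ S t' := fun htt' i hi =>
    (mem_S _ _).2 (pow_le_transitionMatrix_mono hθ hW hdiag htt' ((mem_S _ _).1 hi))
  have hj : ∀ t, j ∈ S t := fun t => mono (Nat.zero_le t) (by simp [mem_S, transitionMatrix])
  have grow : ∀ q, S (q * B) = univ ∨ q + 1 ≤ #(S (q * B)) := by
    intro q
    induction q with
    | zero => exact Or.inr (by simpa using card_pos.2 ⟨j, hj 0⟩)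
    | succ q ih =>
      have hsub : S (q * B) ⊆ S ((q + 1) * B) := mono (Nat.mul_le_mul_right B (Nat.le_succ q))
      by_cases hfull : S (q * B) = univ
      · exact Or.inl (univ_subset_iff.1 (hfull ▸ hsub))
      have hcard := ih.resolve_left hfull
      obtain ⟨b, hb⟩ : ∃ b, b ∉ S (q * B) := by
        by_contra! h
        exact hfull (eq_univ_iff_forall.2 h)
      obtain ⟨u, v, ⟨n, hn, hnpos⟩, hu, hv⟩ := exists_rel_mem_notMem_of_reflTransGen
        (S := (S (q * B) : Set ι)) (hconn (k + q) j b) (mem_coe.2 (hj _)) (by simpa using hb)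
      rw [mem_Ico] at hn
      obtain ⟨t, rfl⟩ : ∃ t, n = k * B + t :=
        ⟨n - k * B, by have := hn.1; rw [add_mul] at this; omega⟩
      have ht : q * B ≤ t ∧ t + 1 ≤ (q + 1) * B := by
        have h₁ := hn.1
        have h₂ := hn.2
        simp only [add_mul] at h₁ h₂ ⊢
        omega
      have hv' : v ∈ S ((q + 1) * B) := mono ht.2 <| (mem_S _ _).2 <|
        pow_succ_le_transitionMatrix hθ hW (hpos _ _ _ hnpos)
          ((mem_S _ _).1 (mono ht.1 (mem_coe.1 hu)))
      exact Or.inr (Nat.succ_le_of_lt (hcard.trans_lt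
        (card_lt_card ⟨hsub, fun h => hv (mem_coe.2 (h hv'))⟩)))
  have hfull : S (Fintype.card ι * B) = univ :=
    (grow _).resolve_right fun h => absurd (card_le_univ (S (Fintype.card ι * B))) (by omega)
  exact (mem_S _ _).1 (hfull ▸ mem_univ i)

end TransitionMatrix

section Perturbation

variable {ι E : Type*} [Fintype ι] [NormedAddCommGroup E] [NormedSpace ℝ E]

lemma norm_sum_smul_le {w : ι → ℝ} (hw : ∀ j, 0 ≤ w j) {x : ι → E} {C : ℝ}
    (hx : ∀ j, ‖x j‖ ≤ C) : ‖∑ j, w j • x j‖ ≤ (∑ j, w j) * C := by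
  rw [sum_mul]
  refine norm_sum_le_of_le _ fun j _ => ?_
  rw [norm_smul, Real.norm_of_nonneg (hw j)]
  exact mul_le_mul_of_nonneg_left (hx j) (hw j)

/-- If the weights are bounded below by `η` and the vectors sum to zero, a weighted sum contracts
by the factor `1 - card ι * η`. -/
lemma norm_sum_smul_le_of_sum_eq_zero {w : ι → ℝ} {η : ℝ} (hw : ∀ j, η ≤ w j)
    (hw1 : ∑ j, w j = 1) {x : ι → E} (hx0 : ∑ j, x j = 0) {C : ℝ} (hx : ∀ j, ‖x j‖ ≤ C) :
    ‖∑ j, w j • x j‖ ≤ (1 - Fintype.card ι * η) * C := by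
  have h := norm_sum_smul_le (w := fun j => w j - η) (fun j => sub_nonneg.2 (hw j)) hx
  simpa [sub_smul, sum_sub_distrib, ← smul_sum, hx0, hw1] using h

variable [DecidableEq ι] {W : ℕ → Matrix ι ι ℝ}

lemma norm_sub_sum_transitionMatrix_smul_le (hW : ∀ n i j, 0 ≤ W n i j)
    (hrow : ∀ n i, ∑ j, W n i j = 1) {e : ι → ℕ → E} {D : ℝ}
    (he : ∀ i n, ‖e i (n + 1) - ∑ j, W n i j • e j n‖ ≤ D) (s t : ℕ) (i : ι) :
    ‖e i (s + t) - ∑ j, transitionMatrix W s t i j • e j s‖ ≤ t * D := by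
  induction t generalizing i with
  | zero => simp [transitionMatrix, Matrix.one_apply]
  | succ t ih =>
    have key : e i (s + (t + 1)) - ∑ j, transitionMatrix W s (t + 1) i j • e j s =
        (e i (s + t + 1) - ∑ k, W (s + t) i k • e k (s + t)) +
          ∑ k, W (s + t) i k • (e k (s + t) - ∑ j, transitionMatrix W s t k j • e j s) := by
      simp only [transitionMatrix, Matrix.mul_apply, smul_sub, sum_sub_distrib, smul_sum,
        sum_smul, smul_smul]
      rw [sum_comm (s := univ) (t := univ), ← add_assoc]
      abel
    have h := norm_sum_smul_le (hW (s + t) i) ih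
    rw [hrow, one_mul] at h
    rw [key]
    push_cast
    linarith [norm_add_le_of_le (he i (s + t)) h]

/-- A perturbed consensus iteration on zero-sum families is bounded when the perturbation is. -/
lemma exists_norm_le_of_perturbed_consensus [Nonempty ι] {θ : ℝ} (hθ : 0 < θ)
    (hW : ∀ n i j, 0 ≤ W n i j) (hpos : ∀ n i j, 0 < W n i j → θ ≤ W n i j)
    (hdiag : ∀ n i, θ ≤ W n i i) (hrow : ∀ n i, ∑ j, W n i j = 1) {B : ℕ} (hB : 0 < B)
    (hconn : ∀ k : ℕ, ∀ a b : ι, Relation.ReflTransGen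
      (fun u v => ∃ n ∈ Ico (k * B) ((k + 1) * B), 0 < W n v u) a b)
    {e : ι → ℕ → E} (hsum : ∀ n, ∑ i, e i n = 0) {D : ℝ}
    (he : ∀ i n, ‖e i (n + 1) - ∑ j, W n i j • e j n‖ ≤ D) :
    ∃ C : ℝ, ∀ n i, ‖e i n‖ ≤ C := by
  set T := Fintype.card ι * B with hT
  have hTpos : 0 < T := Nat.mul_pos Fintype.card_pos hB
  have hD : 0 ≤ D := (norm_nonneg _).trans (he (Classical.arbitrary ι) 0)
  set c : ℝ := Fintype.card ι * θ ^ T with hc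
  have hcpos : 0 < c := mul_pos (Nat.cast_pos.2 Fintype.card_pos) (pow_pos hθ T)
  set C : ℝ := ∑ i, ‖e i 0‖ + T * D / c with hC
  have hCc : T * D ≤ c * C := by
    have : c * (T * D / c) = T * D := mul_div_cancel₀ _ hcpos.ne'
    have h0 : 0 ≤ c * ∑ i, ‖e i 0‖ := mul_nonneg hcpos.le (sum_nonneg fun i _ => norm_nonneg _)
    rw [hC, mul_add]
    linarith
  have hperturb := norm_sub_sum_transitionMatrix_smul_le hW hrow he
  have hperiod : ∀ p i, ‖e i (p * T)‖ ≤ C := by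
    intro p
    induction p with
    | zero =>
      intro i
      have h := single_le_sum (f := fun i => ‖e i 0‖) (fun i _ => norm_nonneg _) (mem_univ i)
      have h' : 0 ≤ T * D / c := by positivity
      rw [zero_mul, hC]
      linarith
    | succ p ih =>
      intro i
      have hentry := fun j => pow_le_transitionMatrix hθ.le hW hpos hdiag hconn
        (p * Fintype.card ι) i j
      rw [mul_assoc, ← hT] at hentry
      have h := norm_sum_smul_le_of_sum_eq_zero hentry (sum_transitionMatrix hrow _ _ i)
        (hsum (p * T)) ih
      have h' := norm_le_norm_add_norm_sub' (e i (p * T + T))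
        (∑ j, transitionMatrix W (p * T) T i j • e j (p * T))
      rw [add_mul, one_mul]
      linarith [hperturb (p * T) T i]
  refine ⟨C + T * D, fun n i => ?_⟩
  have hn : n / T * T + n % T = n := Nat.div_add_mod' n T
  have h := norm_sum_smul_le (transitionMatrix_nonneg hW (n / T * T) (n % T) i)
    (hperiod (n / T))
  rw [sum_transitionMatrix hrow, one_mul] at h
  have h₁ := hperturb (n / T * T) (n % T) i
  rw [hn] at h₁
  have h₂ : ((n % T : ℕ) : ℝ) * D ≤ T * D :=
    mul_le_mul_of_nonneg_right (Nat.cast_le.2 (Nat.mod_lt n hTpos).le) hD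
  have h₃ := norm_le_norm_add_norm_sub' (e i n)
    (∑ j, transitionMatrix W (n / T * T) (n % T) i j • e j (n / T * T))
  linarith

end Perturbation


/-- Uniform boundedness of the dynamic-consensus tracking error: if the signals `r_i[n]`
are uniformly bounded and `y_i[n]` follows the dynamic average-consensus recursion driven
by doubly stochastic, `B`-strongly connected weight matrices, then
`sup_n max_i ‖y_i[n] − r̄[n]‖ < ∞`. -/
theorem stmt_16 {m I : ℕ} (hI : 0 < I)
    (W : ℕ → Fin I → Fin I → ℝ)
    (θ : ℝ) (hθ : θ ∈ Set.Ioo (0 : ℝ) 1)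
    (hWentries : ∀ n i j, W n i j = 0 ∨ W n i j ∈ Set.Icc θ 1)
    (hWdiag : ∀ n i, θ ≤ W n i i)
    (hWrow : ∀ n i, ∑ j, W n i j = 1)
    (hWcol : ∀ n j, ∑ i, W n i j = 1)
    (B : ℕ) (hB : 0 < B)
    (hconn : ∀ k : ℕ, ∀ a b : Fin I,
      Relation.ReflTransGen
        (fun u v : Fin I => ∃ n ∈ Finset.Ico (k * B) ((k + 1) * B), 0 < W n v u) a b)
    (r : Fin I → ℕ → EuclideanSpace ℝ (Fin m))
    (R : ℝ) (hr : ∀ i n, ‖r i n‖ ≤ R)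
    (y : Fin I → ℕ → EuclideanSpace ℝ (Fin m))
    (hy0 : ∀ i, y i 0 = r i 0)
    (hyrec : ∀ i n, y i (n + 1) = (∑ j, W n i j • y j n) + r i (n + 1) - r i n) :
    ∃ C : ℝ, ∀ n : ℕ, ∀ i : Fin I,
      ‖y i n - (I : ℝ)⁻¹ • ∑ j, r j n‖ ≤ C := by
  have : Nonempty (Fin I) := ⟨⟨0, hI⟩⟩
  have hI' : (I : ℝ) ≠ 0 := Nat.cast_ne_zero.2 hI.ne'
  have hW : ∀ n i j, 0 ≤ W n i j := fun n i j =>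
    (hWentries n i j).elim (fun h => h.ge) fun h => hθ.1.le.trans h.1
  have hpos : ∀ n i j, 0 < W n i j → θ ≤ W n i j := fun n i j h =>
    ((hWentries n i j).resolve_left h.ne').1
  have hsum : ∀ n, ∑ i, y i n = ∑ i, r i n := by
    intro n
    induction n with
    | zero => simp [hy0]
    | succ n ih =>
      simp only [hyrec, sum_sub_distrib, sum_add_distrib]
      rw [sum_comm]
      simp [← sum_smul, hWcol, ih]
  have hmean : ∀ n, ‖(I : ℝ)⁻¹ • ∑ j, r j n‖ ≤ R := by
    intro n
    have h := norm_sum_smul_le (w := fun _ : Fin I => (I : ℝ)⁻¹) (fun _ => by positivity)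
      (fun j => hr j n)
    simpa [← smul_sum, hI'] using h
  refine exists_norm_le_of_perturbed_consensus
    (e := fun i n => y i n - (I : ℝ)⁻¹ • ∑ j, r j n) (D := R + R + (R + R))
    hθ.1 hW hpos hWdiag hWrow hB hconn (fun n => ?_) fun i n => ?_
  · simp [sum_sub_distrib, hsum, ← Nat.cast_smul_eq_nsmul ℝ, smul_smul, hI']
  · have key : y i (n + 1) - (I : ℝ)⁻¹ • ∑ j, r j (n + 1) -
        ∑ k, W n i k • (y k n - (I : ℝ)⁻¹ • ∑ j, r j n) =
        (r i (n + 1) - r i n) -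
          ((I : ℝ)⁻¹ • ∑ j, r j (n + 1) - (I : ℝ)⁻¹ • ∑ j, r j n) := by
      simp only [smul_sub, sum_sub_distrib]
      rw [← sum_smul, hWrow, one_smul, hyrec]
      abel
    rw [key]
    exact norm_sub_le_of_le (norm_sub_le_of_le (hr _ _) (hr _ _))
      (norm_sub_le_of_le (hmean _) (hmean _))
end
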